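/- arXiv:1205.3873 — 6 statements merged into one kernel-verified Lean document; each statement's English description precedes it below -/
import Mathlib

section
/- Let P > 0 and A > 0 be real numbers, and let k : ℝ → ℝ be a function that is integrable on [0, P] and satisfies k(x) ≥ 1 for all x ∈ [0, P]. Assume the Gauss–Bonnet relation ∫₀^P k(x) dx = 2π + A and the hyperbolic isoperimetric inequality A² + 4πA − P² ≤ 0. Then ∫₀^P √(k(x)² − 1) dx ≤ 2π. -/
open Real MeasureTheory intervalIntegral

/-- Weighted AM-GM for `√(y² - 1) = √((y - 1) (y + 1))`. -/
theorem sqrt_sq_sub_one_le_weighted {t y : ℝ} (ht : 0 < t) (hy : 1 ≤ y) :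
    √(y ^ 2 - 1) ≤ (t * (y - 1) + (y + 1) / t) / 2 := by
  have ha : 0 ≤ t * (y - 1) := mul_nonneg ht.le (by linarith)
  have hb : 0 ≤ (y + 1) / t := by positivity
  have hab : t * (y - 1) * ((y + 1) / t) = y ^ 2 - 1 := by
    field_simp
    ring
  apply Real.sqrt_le_iff.mpr
  constructor
  · positivity
  · nlinarith [sq_nonneg (t * (y - 1) - (y + 1) / t)]

/-- Integrated form of `sqrt_sq_sub_one_le_weighted`. -/
theorem integral_sqrt_sq_sub_one_le_weighted {P t : ℝ} {k : ℝ → ℝ} (hP : 0 ≤ P) (ht : 0 < t)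
    (hint : IntervalIntegrable k volume 0 P) (hk : ∀ x ∈ Set.Icc (0 : ℝ) P, 1 ≤ k x) :
    ∫ x in (0 : ℝ)..P, √(k x ^ 2 - 1) ≤
      (t * ((∫ x in (0 : ℝ)..P, k x) - P) + ((∫ x in (0 : ℝ)..P, k x) + P) / t) / 2 := by
  have hsub := (hint.sub (intervalIntegrable_const (c := (1 : ℝ)))).const_mul t
  have hadd := (hint.add (intervalIntegrable_const (c := (1 : ℝ)))).div_const t
  calc
    ∫ x in (0 : ℝ)..P, √(k x ^ 2 - 1)
        ≤ ∫ x in (0 : ℝ)..P, (t * (k x - 1) + (k x + 1) / t) / 2 := by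
      rw [integral_of_le hP, integral_of_le hP]
      refine integral_mono_of_nonneg (.of_forall fun _ => Real.sqrt_nonneg _)
        ((hsub.add hadd).div_const 2).1 ?_
      filter_upwards [ae_restrict_mem measurableSet_Ioc] with x hx
      exact sqrt_sq_sub_one_le_weighted ht (hk x (Set.Ioc_subset_Icc_self hx))
    _ = _ := by
      rw [intervalIntegral.integral_div, intervalIntegral.integral_add hsub hadd,
        intervalIntegral.integral_const_mul, intervalIntegral.integral_div,
        intervalIntegral.integral_sub hint intervalIntegrable_const,
        intervalIntegral.integral_add hint intervalIntegrable_const]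
      simp

/-- Hyperbolic rigidity lemma (Section 5): if `k ≥ 1` is integrable on `[0, P]`,
Gauss–Bonnet gives `∫₀^P k = 2π + A`, and the hyperbolic isoperimetric inequality
`A² + 4πA − P² ≤ 0` holds, then `∫₀^P √(k² − 1) ≤ 2π`. -/
theorem hyperbolic_total_root_curvature_le
    (P A : ℝ) (hP : 0 < P) (hA : 0 < A) (k : ℝ → ℝ)
    (hint : IntervalIntegrable k volume 0 P)
    (hk : ∀ x ∈ Set.Icc (0 : ℝ) P, 1 ≤ k x)
    (hGB : ∫ x in (0:ℝ)..P, k x = 2 * π + A)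
    (hisop : A ^ 2 + 4 * π * A - P ^ 2 ≤ 0) :
    ∫ x in (0:ℝ)..P, Real.sqrt (k x ^ 2 - 1) ≤ 2 * π := by
  have ht : 0 < (2 * π + A + P) / (2 * π) := by positivity
  have h := integral_sqrt_sq_sub_one_le_weighted hP.le ht hint hk
  rw [hGB] at h
  have hfst : (2 * π + A + P) / (2 * π) * (2 * π + A - P) ≤ 2 * π := by
    rw [div_mul_eq_mul_div, div_le_iff₀ (by positivity)]
    nlinarith
  have hsnd : (2 * π + A + P) / ((2 * π + A + P) / (2 * π)) = 2 * π :=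
    div_div_cancel₀ (by positivity)
  linarith
end

section
/- Let P > 0 and A > 0 be real numbers, and let k : ℝ → ℝ be a function that is integrable on [0, P] and satisfies k(x) ≥ 0 for all x ∈ [0, P]. Assume the Gauss–Bonnet relation ∫₀^P k(x) dx = 2π − A and the spherical isoperimetric inequality P² + A² − 4πA ≥ 0. Then ∫₀^P √(k(x)² + 1) dx ≥ 2π. -/
open Real MeasureTheory intervalIntegral

theorem IntervalIntegrable.sqrt_sq_add_one {f : ℝ → ℝ} {a b : ℝ}
    (hf : IntervalIntegrable f volume a b) :
    IntervalIntegrable (fun x => √(f x ^ 2 + 1)) volume a b := by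
  refine (hf.norm.add (intervalIntegrable_const (c := (1 : ℝ)))).mono_fun ?_ ?_
  · have hcont : Continuous fun y : ℝ => √(y ^ 2 + 1) := by fun_prop
    exact hcont.comp_aestronglyMeasurable hf.def'.aestronglyMeasurable
  · refine Filter.Eventually.of_forall fun x => ?_
    simp only [Real.norm_eq_abs]
    rw [abs_of_nonneg (sqrt_nonneg _), abs_of_nonneg (by positivity)]
    refine sqrt_le_iff.mpr ⟨by positivity, ?_⟩
    nlinarith [abs_nonneg (f x), sq_abs (f x)]

/-- The chord of a graph is no longer than its arc, in terms of the slope `f`. -/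
theorem sqrt_sq_add_sq_integral_le {f : ℝ → ℝ} {a b : ℝ} (hab : a ≤ b)
    (hf : IntervalIntegrable f volume a b) :
    √((b - a) ^ 2 + (∫ x in a..b, f x) ^ 2) ≤ ∫ x in a..b, √(f x ^ 2 + 1) := by
  set I := ∫ x in a..b, f x with hI
  set R := √((b - a) ^ 2 + I ^ 2) with hR
  have hRsq : R ^ 2 = (b - a) ^ 2 + I ^ 2 := sq_sqrt (by positivity)
  have hpoint : ∀ y : ℝ, I * y + (b - a) ≤ R * √(y ^ 2 + 1) := fun y => by
    rw [hR, ← sqrt_mul (by positivity)]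
    refine le_sqrt_of_sq_le ?_
    nlinarith [sq_nonneg (I - (b - a) * y)]
  have hmono : ∫ x in a..b, (I * f x + (b - a)) ≤ ∫ x in a..b, R * √(f x ^ 2 + 1) :=
    integral_mono_on hab ((hf.const_mul I).add intervalIntegrable_const)
      (hf.sqrt_sq_add_one.const_mul R) fun x _ => hpoint (f x)
  rw [integral_add (hf.const_mul I) intervalIntegrable_const,
    intervalIntegral.integral_const_mul, intervalIntegral.integral_const_mul,
    intervalIntegral.integral_const, smul_eq_mul, ← hI] at hmono
  rcases (show 0 ≤ R from sqrt_nonneg _).eq_or_lt with h0 | hpos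
  · rw [← h0]
    exact integral_nonneg hab fun x _ => sqrt_nonneg _
  · refine le_of_mul_le_mul_left ?_ hpos
    nlinarith

/-- Spherical rigidity lemma (Section 6): if `k ≥ 0` is integrable on `[0, P]`,
Gauss–Bonnet gives `∫₀^P k = 2π − A`, and the spherical isoperimetric inequality
`P² + A² − 4πA ≥ 0` holds, then `∫₀^P √(k² + 1) ≥ 2π`. -/
theorem spherical_total_root_curvature_ge
    (P A : ℝ) (hP : 0 < P) (hA : 0 < A) (k : ℝ → ℝ)
    (hint : IntervalIntegrable k volume 0 P)
    (hk : ∀ x ∈ Set.Icc (0 : ℝ) P, 0 ≤ k x)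
    (hGB : ∫ x in (0:ℝ)..P, k x = 2 * π - A)
    (hisop : 0 ≤ P ^ 2 + A ^ 2 - 4 * π * A) :
    2 * π ≤ ∫ x in (0:ℝ)..P, Real.sqrt (k x ^ 2 + 1) := by
  refine le_trans (le_sqrt_of_sq_le ?_) (sqrt_sq_add_sq_integral_le hP.le hint)
  rw [hGB]
  linarith
end

section
/- For all real numbers a, b with 0 < a < π, 0 < b < π and (a + b)/2 ≤ π/2, one has cot((a + b)/2) ≤ (cot a + cot b)/2, where cot t = cos t / sin t. -/
open Real

theorem sin_mul_sin_le_sin_midpoint_sq (a b : ℝ) :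
    Real.sin a * Real.sin b ≤ Real.sin ((a + b) / 2) ^ 2 := by
  have ha : Real.sin a = Real.sin ((a + b) / 2 + (a - b) / 2) := by ring_nf
  have hb : Real.sin b = Real.sin ((a + b) / 2 - (a - b) / 2) := by ring_nf
  have h : Real.sin a * Real.sin b =
      Real.sin ((a + b) / 2) ^ 2 - Real.sin ((a - b) / 2) ^ 2 := by
    rw [ha, hb, Real.sin_add, Real.sin_sub]
    linear_combination Real.sin ((a + b) / 2) ^ 2 * Real.sin_sq_add_cos_sq ((a - b) / 2) -
      Real.sin ((a - b) / 2) ^ 2 * Real.sin_sq_add_cos_sq ((a + b) / 2)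
  rw [h]
  exact sub_le_self _ (sq_nonneg _)

/-- Lemma 6.1: midpoint inequality for the cotangent, `cot t = cos t / sin t`. -/
theorem cot_midpoint_le (a b : ℝ) (ha0 : 0 < a) (haπ : a < π)
    (hb0 : 0 < b) (hbπ : b < π) (hab : (a + b) / 2 ≤ π / 2) :
    Real.cos ((a + b) / 2) / Real.sin ((a + b) / 2) ≤
      (Real.cos a / Real.sin a + Real.cos b / Real.sin b) / 2 := by
  have hsa : 0 < Real.sin a := Real.sin_pos_of_pos_of_lt_pi ha0 haπ
  have hsb : 0 < Real.sin b := Real.sin_pos_of_pos_of_lt_pi hb0 hbπ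
  have hs : 0 < Real.sin ((a + b) / 2) :=
    Real.sin_pos_of_pos_of_lt_pi (by linarith) (by linarith)
  have hc : 0 ≤ Real.cos ((a + b) / 2) :=
    Real.cos_nonneg_of_neg_pi_div_two_le_of_le (by linarith) hab
  have hsum : Real.cos a * Real.sin b + Real.sin a * Real.cos b =
      2 * Real.sin ((a + b) / 2) * Real.cos ((a + b) / 2) := by
    rw [← Real.sin_two_mul, mul_div_cancel₀ _ two_ne_zero, Real.sin_add]
    ring
  rw [div_add_div _ _ hsa.ne' hsb.ne', div_div, div_le_div_iff₀ hs (by positivity), hsum]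
  linarith [mul_le_mul_of_nonneg_left (sin_mul_sin_le_sin_midpoint_sq a b) hc]
end

section
/- For all real numbers x, δ with x ≥ 0, δ ≥ 0 and x + δ < π/2, one has tan(δ/2) ≤ (tan(x + δ) − tan x)/2. -/
open Real

theorem cos_add_mul_cos_sub_le_cos_sq (m h : ℝ) :
    Real.cos (m + h) * Real.cos (m - h) ≤ Real.cos h ^ 2 := by
  rw [Real.cos_add, Real.cos_sub]
  nlinarith [Real.sin_sq_add_cos_sq m, Real.sin_sq_add_cos_sq h, sq_nonneg (Real.sin m)]

theorem tan_sub_tan_eq_sin_sub_div {a b : ℝ} (ha : Real.cos a ≠ 0) (hb : Real.cos b ≠ 0) :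
    Real.tan a - Real.tan b = Real.sin (a - b) / (Real.cos a * Real.cos b) := by
  rw [Real.tan_eq_sin_div_cos, Real.tan_eq_sin_div_cos, div_sub_div _ _ ha hb, Real.sin_sub]

/-- Key step in the proof of Lemma 6.1: for `x, δ ≥ 0` with `x + δ < π/2`,
`tan(δ/2) ≤ (tan(x + δ) − tan x)/2`. -/
theorem tan_half_le_half_tan_sub (x δ : ℝ) (hx : 0 ≤ x) (hδ : 0 ≤ δ)
    (hxδ : x + δ < π / 2) :
    Real.tan (δ / 2) ≤ (Real.tan (x + δ) - Real.tan x) / 2 := by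
  have hπ := Real.pi_pos
  have hcx : 0 < Real.cos x := Real.cos_pos_of_mem_Ioo ⟨by linarith, by linarith⟩
  have hcxδ : 0 < Real.cos (x + δ) := Real.cos_pos_of_mem_Ioo ⟨by linarith, hxδ⟩
  have hc : 0 < Real.cos (δ / 2) := Real.cos_pos_of_mem_Ioo ⟨by linarith, by linarith⟩
  have hs : 0 ≤ Real.sin (δ / 2) :=
    Real.sin_nonneg_of_nonneg_of_le_pi (by linarith) (by linarith)
  have hprod : Real.cos (x + δ) * Real.cos x ≤ Real.cos (δ / 2) ^ 2 := by
    convert cos_add_mul_cos_sub_le_cos_sq (x + δ / 2) (δ / 2) using 3 <;> ring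
  have hsin : Real.sin δ = 2 * Real.sin (δ / 2) * Real.cos (δ / 2) := by
    rw [← Real.sin_two_mul, mul_div_cancel₀ δ two_ne_zero]
  rw [tan_sub_tan_eq_sin_sub_div hcxδ.ne' hcx.ne', add_sub_cancel_left, hsin,
    Real.tan_eq_sin_div_cos, div_div, div_le_div_iff₀ hc (by positivity)]
  nlinarith [mul_le_mul_of_nonneg_left hprod hs]
end

section
/- For every real number k > 0, ∫₀^{π/2} arctan(sin φ / k) · sin φ dφ = (π/2)(√(k² + 1) − k). -/
open Real intervalIntegral

/-- A smooth form of the identity `(arctan ((s / k) tan x) - x)' = k s / (k² + sin² x) - 1`,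
where `s ^ 2 = k ^ 2 + 1`. -/
lemma hasDerivAt_arctan_sin_mul_cos_div {k s : ℝ} (hk : 0 < k) (hs : 0 < s)
    (hsk : s ^ 2 = k ^ 2 + 1) (x : ℝ) :
    HasDerivAt
      (fun x => arctan ((s - k) * (sin x * cos x) / (k * cos x ^ 2 + s * sin x ^ 2)))
      (k * s / (k ^ 2 + sin x ^ 2) - 1) x := by
  have hsc := sin_sq_add_cos_sq x
  have hD : 0 < k * cos x ^ 2 + s * sin x ^ 2 := by
    rcases eq_or_ne (sin x) 0 with h | h
    · have : cos x ^ 2 = 1 := by simpa [h] using hsc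
      simp [h, this, hk]
    · positivity
  have hE : 0 < k ^ 2 + sin x ^ 2 := by positivity
  have hN := ((hasDerivAt_sin x).mul (hasDerivAt_cos x)).const_mul (s - k)
  have hD' := (((hasDerivAt_cos x).pow 2).const_mul k).add
    (((hasDerivAt_sin x).pow 2).const_mul s)
  refine (hN.div hD' hD.ne').arctan.congr_deriv ?_
  simp only [Pi.mul_apply, Pi.add_apply, Pi.pow_apply, Pi.div_apply]
  generalize sin x = a at *
  generalize cos x = c at *
  have hsq : (k * c ^ 2 + s * a ^ 2) ^ 2 + ((s - k) * (a * c)) ^ 2 = k ^ 2 + a ^ 2 := by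
    linear_combination (k ^ 2 * c ^ 2 + s ^ 2 * a ^ 2 + k ^ 2) * hsc + a ^ 2 * hsk
  have h1 : 1 + ((s - k) * (a * c) / (k * c ^ 2 + s * a ^ 2)) ^ 2
      = (k ^ 2 + a ^ 2) / (k * c ^ 2 + s * a ^ 2) ^ 2 := by
    rw [← hsq]; field_simp
  rw [h1]
  field_simp
  grind

lemma hasDerivAt_antideriv_arctan_sin_mul_sin {k s : ℝ} (hk : 0 < k) (hs : 0 < s)
    (hsk : s ^ 2 = k ^ 2 + 1) (x : ℝ) :
    HasDerivAt
      (fun x => s * (x + arctan ((s - k) * (sin x * cos x) / (k * cos x ^ 2 + s * sin x ^ 2)))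
        - k * x - cos x * arctan (sin x / k))
      (arctan (sin x / k) * sin x) x := by
  have hE : 0 < k ^ 2 + sin x ^ 2 := by positivity
  have h := ((((hasDerivAt_id x).add (hasDerivAt_arctan_sin_mul_cos_div hk hs hsk x)).const_mul
    s).sub ((hasDerivAt_id x).const_mul k)).sub
      ((hasDerivAt_cos x).mul ((hasDerivAt_sin x).div_const k).arctan)
  refine h.congr_deriv ?_
  have hsc := sin_sq_add_cos_sq x
  have h1 : 1 + (sin x / k) ^ 2 = (k ^ 2 + sin x ^ 2) / k ^ 2 := by field_simp
  rw [h1]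
  field_simp
  linear_combination k * hsk - k * hsc

/-- Section 6 integral: for `k > 0`,
`∫₀^{π/2} arctan(sin φ / k) sin φ dφ = (π/2)(√(k² + 1) − k)`. -/
theorem integral_arctan_sin (k : ℝ) (hk : 0 < k) :
    ∫ φ in (0:ℝ)..(π / 2), Real.arctan (Real.sin φ / k) * Real.sin φ
      = π / 2 * (Real.sqrt (k ^ 2 + 1) - k) := by
  have hs : 0 < √(k ^ 2 + 1) := by positivity
  have hsk : √(k ^ 2 + 1) ^ 2 = k ^ 2 + 1 := sq_sqrt (by positivity)
  rw [integral_eq_sub_of_hasDerivAt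
    (fun x _ => hasDerivAt_antideriv_arctan_sin_mul_sin hk hs hsk x)
    (Continuous.intervalIntegrable (by fun_prop) _ _)]
  simp
  ring
end

section
/- Let N ≥ 1 be a natural number, and let a, b : ℕ → ℝ be sequences with b(n) > 0 for all 0 ≤ n ≤ N. Suppose ν : ℕ → ℝ satisfies ν(n) > 0 for all 0 ≤ n ≤ N + 1 and the discrete Jacobi equation b(n−1)·ν(n−1) + a(n)·ν(n) + b(n)·ν(n+1) = 0 for all 1 ≤ n ≤ N. If ξ : ℕ → ℝ satisfies the same equation b(n−1)·ξ(n−1) + a(n)·ξ(n) + b(n)·ξ(n+1) = 0 for all 1 ≤ n ≤ N, and ξ(i) = 0 and ξ(k) = 0 for some indices 0 ≤ i < k ≤ N + 1, then ξ(n) = 0 for all i ≤ n ≤ k. -/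
/-- The discrete Wronskian of two solutions of the same Jacobi equation is constant. -/
theorem jacobi_casoratian_const {N : ℕ} {a b ν ξ : ℕ → ℝ}
    (hνJ : ∀ n, 1 ≤ n → n ≤ N → b (n - 1) * ν (n - 1) + a n * ν n + b n * ν (n + 1) = 0)
    (hξJ : ∀ n, 1 ≤ n → n ≤ N → b (n - 1) * ξ (n - 1) + a n * ξ n + b n * ξ (n + 1) = 0)
    {n : ℕ} (hn : n ≤ N) :
    b n * (ξ (n + 1) * ν n - ξ n * ν (n + 1)) = b 0 * (ξ 1 * ν 0 - ξ 0 * ν 1) := by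
  induction n with
  | zero => rfl
  | succ m ih =>
    have h₁ := hνJ (m + 1) (by lia) hn
    have h₂ := hξJ (m + 1) (by lia) hn
    rw [Nat.add_sub_cancel] at h₁ h₂
    rw [← ih (by lia)]
    linear_combination ν (m + 1) * h₂ - ξ (m + 1) * h₁

/-- If the Wronskian of `ξ` with a positive sequence `ν` is positive, then `ξ` is positive
after any zero. -/
theorem pos_of_casoratian_pos {N : ℕ} {b ν ξ : ℕ → ℝ}
    (hb : ∀ n, n ≤ N → 0 < b n) (hν : ∀ n, n ≤ N + 1 → 0 < ν n)
    (hW : ∀ n, n ≤ N → 0 < b n * (ξ (n + 1) * ν n - ξ n * ν (n + 1)))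
    {i : ℕ} (hi : ξ i = 0) {n : ℕ} (hin : i < n) (hn : n ≤ N + 1) : 0 < ξ n := by
  have step : ∀ m, m ≤ N → 0 ≤ ξ m → 0 < ξ (m + 1) := fun m hm hξ => by
    have h := pos_of_mul_pos_right (hW m hm) (hb m hm).le
    have h' := mul_nonneg hξ (hν (m + 1) (by lia)).le
    exact pos_of_mul_pos_left (by linarith) (hν m (by lia)).le
  induction n, hin using Nat.le_induction with
  | base => exact step i (by lia) hi.ge
  | succ m _ ih => exact step m (by lia) (ih (by lia)).le


/-- Section 3 Lemma (discrete Sturm separation): if a positive solution `ν` of the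
discrete Jacobi equation `b(n−1)ξ(n−1) + a(n)ξ(n) + b(n)ξ(n+1) = 0` with positive
off-diagonal coefficients `b` exists along a segment, then any solution `ξ`
vanishing at two indices `i < k` of the segment vanishes identically between them
(no conjugate points). -/
theorem no_conjugate_points_of_positive_jacobi_field
    (N : ℕ) (hN : 1 ≤ N) (a b : ℕ → ℝ)
    (hb : ∀ n, n ≤ N → 0 < b n)
    (ν : ℕ → ℝ) (hν : ∀ n, n ≤ N + 1 → 0 < ν n)
    (hνJ : ∀ n, 1 ≤ n → n ≤ N →
      b (n - 1) * ν (n - 1) + a n * ν n + b n * ν (n + 1) = 0)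
    (ξ : ℕ → ℝ)
    (hξJ : ∀ n, 1 ≤ n → n ≤ N →
      b (n - 1) * ξ (n - 1) + a n * ξ n + b n * ξ (n + 1) = 0)
    (i k : ℕ) (hik : i < k) (hk : k ≤ N + 1)
    (hξi : ξ i = 0) (hξk : ξ k = 0) :
    ∀ n, i ≤ n → n ≤ k → ξ n = 0 := by
  have hW := fun n (hn : n ≤ N) => jacobi_casoratian_const hνJ hξJ hn
  have hc : b 0 * (ξ 1 * ν 0 - ξ 0 * ν 1) = 0 := by
    rcases lt_trichotomy (b 0 * (ξ 1 * ν 0 - ξ 0 * ν 1)) 0 with h | h | h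
    · have hneg := pos_of_casoratian_pos (ξ := -ξ) hb hν
        (fun n hn => by simp only [Pi.neg_apply]; linarith [hW n hn]) (by simp [hξi]) hik hk
      simp [hξk] at hneg
    · exact h
    · have hpos := pos_of_casoratian_pos hb hν (fun n hn => by rwa [hW n hn]) hξi hik hk
      exact absurd hξk hpos.ne'
  intro n hin hnk
  induction n, hin using Nat.le_induction with
  | base => exact hξi
  | succ m _ ih =>
    have h := (hW m (by lia)).trans hc
    rw [ih (by lia), zero_mul, sub_zero] at h
    simpa [(hb m (by lia)).ne', (hν m (by lia)).ne'] using h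
end
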